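/- Let a_{kl} = ∫_{ℝ²} 1_{{x ≤ y}} H_k(x) H_l(y) φ(x) φ(y) dx dy for k, l ≥ 0. Then lim_{k → ∞} k · |a_{k,k+1}| / √(k! (k+1)!) = 1/(2π). -/

import Mathlib

open MeasureTheory Real Filter

/-- Probabilist's Hermite polynomial `H_k(x)`. -/
noncomputable def hermiteFun (k : ℕ) (x : ℝ) : ℝ := Polynomial.aeval x (Polynomial.hermite k)

/-- Standard normal density `φ(x) = (2π)^{-1/2} e^{-x²/2}`. -/
noncomputable def stdNormalDensity (x : ℝ) : ℝ :=
  (Real.sqrt (2 * Real.pi))⁻¹ * Real.exp (-x ^ 2 / 2)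

/-- Hermite coefficients of the Wilcoxon kernel `h(x,y) = 1_{x ≤ y}`. -/
noncomputable def wilcoxonCoeff (k l : ℕ) : ℝ :=
  ∫ q : ℝ × ℝ, (if q.1 ≤ q.2 then (1 : ℝ) else 0) * hermiteFun k q.1 * hermiteFun l q.2 *
    stdNormalDensity q.1 * stdNormalDensity q.2

/-- `∫ H_m(x) H_n(x) e^{-x²} dx`. -/
noncomputable def hermiteIntegral (m n : ℕ) : ℝ :=
  ∫ x : ℝ, hermiteFun m x * hermiteFun n x * Real.exp (-1 * x ^ 2)

theorem derivative_hermite_succ (n : ℕ) :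
    Polynomial.derivative (Polynomial.hermite (n + 1)) =
      ((n : Polynomial ℤ) + 1) * Polynomial.hermite n := by
  induction n with
  | zero => simp
  | succ n ih =>
    rw [Polynomial.hermite_succ (n + 1), ih]
    simp only [Polynomial.derivative_sub, Polynomial.derivative_mul, ih, Polynomial.derivative_X,
      Polynomial.derivative_add, Polynomial.derivative_natCast, Polynomial.derivative_one]
    rw [Polynomial.hermite_succ n]
    push_cast
    ring

theorem integrable_aeval_mul_exp_neg_mul_sq (p : Polynomial ℤ) {b : ℝ} (hb : 0 < b) :
    Integrable fun x : ℝ => Polynomial.aeval x p * Real.exp (-b * x ^ 2) := by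
  simp_rw [Polynomial.aeval_eq_sum_range, Finset.sum_mul]
  refine integrable_finsetSum _ fun i _ => ?_
  have h := integrable_rpow_mul_exp_neg_mul_sq hb
    (show (-1 : ℝ) < (i : ℝ) by linarith [(Nat.cast_nonneg i : (0 : ℝ) ≤ i)])
  simp_rw [Real.rpow_natCast] at h
  simpa [mul_assoc] using h.const_mul (p.coeff i : ℝ)

theorem hasDerivAt_aeval_mul_exp_neg_mul_sq (p : Polynomial ℤ) (b x : ℝ) :
    HasDerivAt (fun x : ℝ => Polynomial.aeval x p * Real.exp (-b * x ^ 2))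
      ((Polynomial.aeval x p.derivative - 2 * b * x * Polynomial.aeval x p) *
        Real.exp (-b * x ^ 2)) x := by
  have h := ((hasDerivAt_pow 2 x).const_mul (-b)).exp
  refine ((p.hasDerivAt_aeval x).mul h).congr_deriv ?_
  push_cast
  ring

theorem integrable_deriv_aeval_mul_exp_neg_mul_sq (p : Polynomial ℤ) {b : ℝ} (hb : 0 < b) :
    Integrable fun x : ℝ =>
      (Polynomial.aeval x p.derivative - 2 * b * x * Polynomial.aeval x p) *
        Real.exp (-b * x ^ 2) := by
  have h := (integrable_aeval_mul_exp_neg_mul_sq p.derivative hb).sub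
    ((integrable_aeval_mul_exp_neg_mul_sq (Polynomial.X * p) hb).const_mul (2 * b))
  refine h.congr (ae_of_all _ fun x => ?_)
  simp
  ring

theorem integral_deriv_aeval_mul_exp_neg_mul_sq (p : Polynomial ℤ) {b : ℝ} (hb : 0 < b) :
    ∫ x : ℝ, (Polynomial.aeval x p.derivative - 2 * b * x * Polynomial.aeval x p) *
      Real.exp (-b * x ^ 2) = 0 :=
  integral_eq_zero_of_hasDerivAt_of_integrable (hasDerivAt_aeval_mul_exp_neg_mul_sq p b)
    (integrable_deriv_aeval_mul_exp_neg_mul_sq p hb) (integrable_aeval_mul_exp_neg_mul_sq p hb)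

theorem integral_Iic_deriv_aeval_mul_exp_neg_mul_sq (p : Polynomial ℤ) {b : ℝ} (hb : 0 < b)
    (y : ℝ) :
    ∫ x in Set.Iic y, (Polynomial.aeval x p.derivative - 2 * b * x * Polynomial.aeval x p) *
      Real.exp (-b * x ^ 2) = Polynomial.aeval y p * Real.exp (-b * y ^ 2) := by
  have hd := hasDerivAt_aeval_mul_exp_neg_mul_sq p b
  have hi := integrable_deriv_aeval_mul_exp_neg_mul_sq p hb
  rw [integral_Iic_of_hasDerivAt_of_tendsto' (fun x _ => hd x) hi.integrableOn
    (tendsto_zero_of_hasDerivAt_of_integrableOn_Iic (a := 0) (fun x _ => hd x) hi.integrableOn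
      (integrable_aeval_mul_exp_neg_mul_sq p hb).integrableOn), sub_zero]

theorem integrable_hermiteFun_mul_hermiteFun (m n : ℕ) :
    Integrable fun x : ℝ => hermiteFun m x * hermiteFun n x * Real.exp (-1 * x ^ 2) := by
  simpa [hermiteFun] using integrable_aeval_mul_exp_neg_mul_sq
    (Polynomial.hermite m * Polynomial.hermite n) one_pos

theorem hermiteIntegral_succ_right (m n : ℕ) :
    hermiteIntegral m (n + 1) = -hermiteIntegral (m + 1) n := by
  have h := integral_deriv_aeval_mul_exp_neg_mul_sq
    (Polynomial.hermite m * Polynomial.hermite n) one_pos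
  have hsum : hermiteIntegral m (n + 1) + hermiteIntegral (m + 1) n = 0 := by
    rw [hermiteIntegral, hermiteIntegral,
      ← integral_add (integrable_hermiteFun_mul_hermiteFun _ _)
        (integrable_hermiteFun_mul_hermiteFun _ _), ← neg_eq_zero, ← integral_neg, ← h]
    congr 1 with x
    simp [hermiteFun, Polynomial.hermite_succ, Polynomial.derivative_mul]
    ring
  linarith

theorem hermiteIntegral_add_right (m n j : ℕ) :
    hermiteIntegral m (n + j) = (-1) ^ j * hermiteIntegral (m + j) n := by
  induction j generalizing m with
  | zero => simp
  | succ j ih =>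
    rw [← add_assoc, hermiteIntegral_succ_right, ih, show m + 1 + j = m + (j + 1) by ring]
    ring

theorem hermiteIntegral_zero_add_two (n : ℕ) :
    hermiteIntegral 0 (n + 2) = -((n + 1) / 2) * hermiteIntegral 0 n := by
  have h := integral_deriv_aeval_mul_exp_neg_mul_sq (Polynomial.hermite (n + 1)) one_pos
  have hsum : 2 * hermiteIntegral 0 (n + 2) + (n + 1) * hermiteIntegral 0 n = 0 := by
    rw [hermiteIntegral, hermiteIntegral, ← integral_const_mul, ← integral_const_mul,
      ← integral_add ((integrable_hermiteFun_mul_hermiteFun _ _).const_mul _)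
        ((integrable_hermiteFun_mul_hermiteFun _ _).const_mul _), ← neg_eq_zero, ← integral_neg,
      ← h]
    congr 1 with x
    rw [hermiteFun, hermiteFun, hermiteFun, Polynomial.hermite_succ (n + 1),
      derivative_hermite_succ]
    simp
    ring
  linarith

theorem hermiteIntegral_self_succ (k : ℕ) :
    hermiteIntegral (k + 1) (k + 1) = (k + 1 / 2) * hermiteIntegral k k := by
  have h0 := hermiteIntegral_add_right 0 k k
  have h1 := hermiteIntegral_add_right 0 (k + 1) (k + 1)
  have h2 := hermiteIntegral_zero_add_two (k + k)
  rw [show k + 1 + (k + 1) = k + k + 2 by ring, h2, h0, pow_succ] at h1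
  simp only [zero_add] at h1
  have hs : ((-1 : ℝ) ^ k) * (-1) ^ k = 1 := by rw [← mul_pow]; simp
  push_cast at h1
  linear_combination ((-1 : ℝ) ^ k) * h1 +
    ((k + 1 / 2) * hermiteIntegral k k - hermiteIntegral (k + 1) (k + 1)) * hs

theorem hermiteIntegral_zero_zero : hermiteIntegral 0 0 = √π := by
  have h := integral_gaussian 1
  simpa [hermiteIntegral, hermiteFun] using h

theorem hermiteIntegral_self_pos (k : ℕ) : 0 < hermiteIntegral k k := by
  induction k with
  | zero => rw [hermiteIntegral_zero_zero]; positivity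
  | succ k ih => rw [hermiteIntegral_self_succ]; positivity

theorem hermiteIntegral_self_sq_mul_wallis (k : ℕ) :
    hermiteIntegral k k ^ 2 * (Real.Wallis.W k * (2 * k + 1)) = π * (k.factorial : ℝ) ^ 2 := by
  induction k with
  | zero => simp [hermiteIntegral_zero_zero, Real.Wallis.W, Real.sq_sqrt Real.pi_pos.le]
  | succ k ih =>
    rw [hermiteIntegral_self_succ, Real.Wallis.W_succ, Nat.factorial_succ]
    push_cast
    rw [mul_pow _ (k.factorial : ℝ), mul_left_comm π, ← ih]
    field_simp
    ring

theorem hermiteFun_succ_mul_stdNormalDensity (k : ℕ) (x : ℝ) :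
    hermiteFun (k + 1) x * stdNormalDensity x =
      -(√(2 * π))⁻¹ * ((Polynomial.aeval x (Polynomial.hermite k).derivative -
        2 * (1 / 2 : ℝ) * x * Polynomial.aeval x (Polynomial.hermite k)) *
          Real.exp (-(1 / 2 : ℝ) * x ^ 2)) := by
  rw [hermiteFun, stdNormalDensity, Polynomial.hermite_succ,
    show -x ^ 2 / 2 = -(1 / 2 : ℝ) * x ^ 2 by ring]
  simp
  ring

theorem hermiteFun_mul_stdNormalDensity (k : ℕ) (x : ℝ) :
    hermiteFun k x * stdNormalDensity x =
      (√(2 * π))⁻¹ * (Polynomial.aeval x (Polynomial.hermite k) *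
        Real.exp (-(1 / 2 : ℝ) * x ^ 2)) := by
  rw [hermiteFun, stdNormalDensity, show -x ^ 2 / 2 = -(1 / 2 : ℝ) * x ^ 2 by ring]
  ring

theorem integrable_hermiteFun_mul_stdNormalDensity (k : ℕ) :
    Integrable fun x : ℝ => hermiteFun k x * stdNormalDensity x := by
  simp_rw [hermiteFun_mul_stdNormalDensity]
  exact (integrable_aeval_mul_exp_neg_mul_sq _ one_half_pos).const_mul _

theorem integral_Iic_hermiteFun_succ (k : ℕ) (y : ℝ) :
    ∫ x in Set.Iic y, hermiteFun (k + 1) x * stdNormalDensity x =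
      -(hermiteFun k y * stdNormalDensity y) := by
  simp_rw [hermiteFun_succ_mul_stdNormalDensity, integral_const_mul,
    integral_Iic_deriv_aeval_mul_exp_neg_mul_sq _ one_half_pos, hermiteFun_mul_stdNormalDensity]
  ring

theorem wilcoxonCoeff_succ_left (k l : ℕ) :
    wilcoxonCoeff (k + 1) l = -(2 * π)⁻¹ * hermiteIntegral k l := by
  have hprod := (integrable_hermiteFun_mul_stdNormalDensity (k + 1)).mul_prod
    (integrable_hermiteFun_mul_stdNormalDensity l)
  have hmeas : MeasurableSet {q : ℝ × ℝ | q.1 ≤ q.2} :=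
    measurableSet_le measurable_fst measurable_snd
  have hint : Integrable (fun q : ℝ × ℝ => (if q.1 ≤ q.2 then (1 : ℝ) else 0) *
      hermiteFun (k + 1) q.1 * hermiteFun l q.2 * stdNormalDensity q.1 * stdNormalDensity q.2)
      (volume.prod volume) := by
    refine (hprod.indicator hmeas).congr (ae_of_all _ fun q => ?_)
    by_cases hq : q.1 ≤ q.2
    · simp [hq]
      ring
    · simp [hq]
  rw [wilcoxonCoeff, Measure.volume_eq_prod, integral_prod_symm _ hint, hermiteIntegral,
    ← integral_const_mul]
  congr 1 with y
  have hinner : ∀ x : ℝ, (if x ≤ y then (1 : ℝ) else 0) * hermiteFun (k + 1) x *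
      hermiteFun l y * stdNormalDensity x * stdNormalDensity y =
      (hermiteFun l y * stdNormalDensity y) *
        (Set.Iic y).indicator (fun x => hermiteFun (k + 1) x * stdNormalDensity x) x := by
    intro x
    by_cases hx : x ≤ y
    · simp [hx]
      ring
    · simp [hx]
  simp_rw [hinner]
  rw [integral_const_mul, integral_indicator measurableSet_Iic, integral_Iic_hermiteFun_succ]
  have hexp : Real.exp (-1 * y ^ 2) = Real.exp (-y ^ 2 / 2) * Real.exp (-y ^ 2 / 2) := by
    rw [← Real.exp_add]
    congr 1
    ring
  have hpi : (2 * π)⁻¹ = (√(2 * π))⁻¹ * (√(2 * π))⁻¹ := by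
    rw [← mul_inv, Real.mul_self_sqrt (by positivity)]
  rw [hexp, hpi, stdNormalDensity]
  ring

theorem wilcoxonCoeff_self_succ (k : ℕ) :
    wilcoxonCoeff (k + 1) (k + 2) = (2 * π)⁻¹ * hermiteIntegral (k + 1) (k + 1) := by
  rw [wilcoxonCoeff_succ_left, hermiteIntegral_succ_right]
  ring

theorem mul_hermiteIntegral_div_sqrt_factorial (k : ℕ) :
    k * hermiteIntegral k k / √(k.factorial * (k + 1).factorial) =
      √(π * ((k / (k + 1)) * (k / (2 * k + 1))) / Real.Wallis.W k) := by
  have hW := Real.Wallis.W_pos k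
  have hJ := hermiteIntegral_self_pos k
  rw [eq_comm, Real.sqrt_eq_iff_eq_sq (by positivity) (by positivity), div_pow,
    Real.sq_sqrt (by positivity), mul_pow, Nat.factorial_succ]
  have h := hermiteIntegral_self_sq_mul_wallis k
  push_cast
  field_simp
  linear_combination (-(k : ℝ) ^ 2) * h

theorem tendsto_mul_hermiteIntegral_div_sqrt_factorial :
    Tendsto (fun k : ℕ => k * hermiteIntegral k k / √(k.factorial * (k + 1).factorial))
      atTop (nhds 1) := by
  simp_rw [mul_hermiteIntegral_div_sqrt_factorial]
  have h := (((tendsto_natCast_div_add_atTop (1 : ℝ)).mul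
    Stirling.tendsto_self_div_two_mul_self_add_one).const_mul π).div
      Real.Wallis.tendsto_W_nhds_pi_div_two (by positivity)
  rw [show π * (1 * (1 / 2)) / (π / 2) = 1 by field_simp] at h
  simpa using h.sqrt

/-- `k |a_{k,k+1}| / √(k! (k+1)!) → 1/(2π)` as `k → ∞`. -/
theorem wilcoxonCoeff_diag_asymptotics :
    Tendsto (fun k : ℕ =>
        (k : ℝ) * |wilcoxonCoeff k (k + 1)| / Real.sqrt (k.factorial * (k + 1).factorial))
      atTop (nhds (1 / (2 * Real.pi))) := by
  have h := tendsto_mul_hermiteIntegral_div_sqrt_factorial.const_mul (1 / (2 * π))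
  rw [mul_one] at h
  refine h.congr' ?_
  filter_upwards [eventually_ge_atTop 1] with k hk
  obtain ⟨n, rfl⟩ := Nat.exists_eq_add_of_le' hk
  have hJ := hermiteIntegral_self_pos (n + 1)
  rw [wilcoxonCoeff_self_succ, abs_of_nonneg (by positivity)]
  ring
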